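/- There exist a σ-finite measure space (X,μ) with μ nonatomic and μ(X) = ∞, and an invertible measure-preserving transformation T of (X,μ), such that T is ergodic with isometric coefficients, the Cartesian square T × T is conservative with respect to μ × μ, but T × T is not ergodic with respect to μ × μ. -/

import Mathlib

open MeasureTheory Filter Set
open scoped ENNReal

/-- `R` is conservative with respect to `ν`. -/
def IsConservative {Y : Type*} [MeasurableSpace Y] (ν : Measure Y) (R : Y → Y) : Prop :=
  ∀ A : Set Y, MeasurableSet A → 0 < ν A → ∃ n : ℕ, 1 ≤ n ∧ 0 < ν (A ∩ R^[n] ⁻¹' A)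

/-- `R` is ergodic with respect to `ν`: invariant sets are null or conull. -/
def IsErgodicT {Y : Type*} [MeasurableSpace Y] (ν : Measure Y) (R : Y → Y) : Prop :=
  ∀ A : Set Y, MeasurableSet A → R ⁻¹' A = A → ν A = 0 ∨ ν Aᶜ = 0

/-- `T` is ergodic with isometric coefficients: every Borel map into a separable metric
space intertwining `T` with a surjective isometry is almost everywhere constant. -/
def EIC {X : Type*} [MeasurableSpace X] (μ : Measure X) (T : X → X) : Prop :=
  ∀ (Z : Type) [MetricSpace Z] [TopologicalSpace.SeparableSpace Z]
    [MeasurableSpace Z] [BorelSpace Z] (S : Z ≃ᵢ Z) (φ : X → Z),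
    Measurable φ → (∀ᵐ x ∂μ, φ (T x) = S (φ x)) → ∃ z : Z, ∀ᵐ x ∂μ, φ x = z

open scoped Topology

/-! ### Heights and return times -/

/-- The height of the tower after `k` steps: `1, 4, 13, 40, …`. -/
def repunit : ℕ → ℕ
  | 0 => 1
  | k + 1 => 3 * repunit k + 1

/-- The return time to the base at points whose successor has dyadic valuation `k`. -/
def gap : ℕ → ℕ
  | 0 => 1
  | k + 1 => gap k + repunit k + 1

/-- The total time spent by the first `m` passages through the base. -/
noncomputable def weight (m : ℕ) : ℕ :=
  ∑ j ∈ Finset.range m, gap (multiplicity 2 (j + 1))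

lemma gap_pos (k : ℕ) : 0 < gap k := by
  cases k <;> simp [gap]

lemma gap_mono : Monotone gap :=
  monotone_nat_of_le_succ fun k => by simp only [gap]; omega

lemma three_pow_le_repunit (k : ℕ) : 3 ^ k ≤ repunit k := by
  induction k with
  | zero => simp [repunit]
  | succ k ih => simp only [repunit, pow_succ]; omega

lemma three_pow_le_gap_succ (k : ℕ) : 3 ^ k ≤ gap (k + 1) := by
  have := three_pow_le_repunit k
  simp only [gap]
  omega

lemma two_mul_sum_repunit_lt (k : ℕ) : 2 * ∑ i ∈ Finset.range k, repunit i < repunit k := by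
  induction k with
  | zero => simp [repunit]
  | succ k ih => rw [Finset.sum_range_succ, repunit]; omega

@[simp]
lemma weight_zero : weight 0 = 0 := by simp [weight]

lemma weight_succ (m : ℕ) : weight (m + 1) = weight m + gap (multiplicity 2 (m + 1)) :=
  Finset.sum_range_succ _ _

/-- Two elements congruent modulo `2 ^ N` have the same dyadic valuation if it is below `N`. -/
lemma multiplicity_two_eq_of_pow_dvd {R : Type*} [CommRing R] {N n : ℕ} {x : R}
    (hR : ∀ k, (2 : R) ^ k ∣ (n : R) ↔ 2 ^ k ∣ n) (hx : (2 : R) ^ N ∣ x - n)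
    (hn : ¬ 2 ^ N ∣ n) : multiplicity 2 x = multiplicity 2 n := by
  have key : ∀ k ≤ N, ((2 : R) ^ k ∣ x ↔ 2 ^ k ∣ n) := fun k hk => by
    rw [← hR k]
    exact (dvd_iff_dvd_of_dvd_sub ((pow_dvd_pow 2 hk).trans hx))
  have : emultiplicity 2 x = emultiplicity 2 n := by
    rw [emultiplicity_eq_emultiplicity_iff]
    intro k
    rcases le_total k N with hk | hk
    · exact key k hk
    · exact ⟨fun h => absurd ((key N le_rfl).1 ((pow_dvd_pow 2 hk).trans h)) hn,
        fun h => absurd ((pow_dvd_pow 2 hk).trans h) hn⟩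
  exact multiplicity_eq_of_emultiplicity_eq this

lemma multiplicity_two_pow_add {k j : ℕ} (hj : 0 < j) (hjk : j < 2 ^ k) :
    multiplicity 2 (2 ^ k + j) = multiplicity 2 j := by
  have h : emultiplicity 2 (2 ^ k + j) = emultiplicity 2 j := by
    rw [emultiplicity_eq_emultiplicity_iff]
    have hn : ¬ 2 ^ k ∣ j := Nat.not_dvd_of_pos_of_lt hj hjk
    intro l
    rcases le_total l k with hl | hl
    · exact Nat.dvd_add_right (pow_dvd_pow 2 hl)
    · have hd : (2 : ℕ) ^ k ∣ 2 ^ l := pow_dvd_pow 2 hl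
      exact ⟨fun h => absurd ((Nat.dvd_add_right dvd_rfl).1 (hd.trans h)) hn,
        fun h => absurd (hd.trans h) hn⟩
  exact multiplicity_eq_of_emultiplicity_eq h

lemma weight_two_pow_add_eq {k m : ℕ} (hm : m < 2 ^ k) :
    weight (2 ^ k + m) = weight (2 ^ k) + weight m := by
  induction m with
  | zero => simp
  | succ m ih =>
    rw [← add_assoc, weight_succ, ih (by omega), weight_succ, add_assoc (2 ^ k),
      multiplicity_two_pow_add (Nat.succ_pos m) hm, add_assoc]

lemma weight_two_pow (k : ℕ) : weight (2 ^ k) = repunit k := by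
  have hmul : ∀ k : ℕ, multiplicity 2 (2 ^ k) = k := fun k =>
    multiplicity_pow_self_of_prime Nat.prime_two.prime k
  induction k with
  | zero => simp [weight, repunit, gap, show multiplicity 2 1 = 0 from hmul 0]
  | succ k ih =>
    obtain ⟨m, hm⟩ : ∃ m, 2 ^ k = m + 1 := ⟨2 ^ k - 1, by have := Nat.two_pow_pos k; omega⟩
    have h1 : weight (2 ^ k) = weight m + gap k := by
      rw [hm, weight_succ, ← hm, hmul]
    have h2 : weight (2 ^ (k + 1)) = weight (2 ^ k + m) + gap (k + 1) := by
      rw [show 2 ^ (k + 1) = 2 ^ k + m + 1 by omega, weight_succ,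
        show 2 ^ k + m + 1 = 2 ^ (k + 1) by omega, hmul]
    rw [h2, weight_two_pow_add_eq (by omega)]
    simp only [repunit, gap]
    omega

lemma weight_two_pow_add {k m : ℕ} (hm : m < 2 ^ k) :
    weight (2 ^ k + m) = repunit k + weight m := by
  rw [weight_two_pow_add_eq hm, weight_two_pow]

lemma weight_eq_sum_testBit (N : ℕ) {m : ℕ} (hm : m < 2 ^ N) :
    weight m = ∑ i ∈ Finset.range N, (m.testBit i).toNat * repunit i := by
  induction N generalizing m with
  | zero => simp_all
  | succ N ih =>
    rw [Finset.sum_range_succ]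
    rcases lt_or_ge m (2 ^ N) with h | h
    · rw [ih h, Nat.testBit_lt_two_pow h]
      simp
    · obtain ⟨m, rfl⟩ := Nat.exists_eq_add_of_le h
      have hm' : m < 2 ^ N := by omega
      rw [weight_two_pow_add hm', ih hm', Nat.testBit_two_pow_add_eq, Nat.testBit_lt_two_pow hm']
      rw [Finset.sum_congr rfl fun i hi => by
        rw [← Nat.testBit_two_pow_add_gt (Finset.mem_range.1 hi)]]
      simp [add_comm]

/-- The heights are dissociated. -/
lemma eq_zero_of_sum_mul_repunit_eq_zero {a : ℕ → ℤ} (ha : ∀ i, |a i| ≤ 2) (N : ℕ)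
    (h : ∑ i ∈ Finset.range N, a i * repunit i = 0) : ∀ i < N, a i = 0 := by
  induction N with
  | zero => simp
  | succ N ih =>
    have hb : |∑ i ∈ Finset.range N, a i * repunit i| < repunit N := by
      calc |∑ i ∈ Finset.range N, a i * repunit i|
          ≤ ∑ i ∈ Finset.range N, |a i * repunit i| := Finset.abs_sum_le_sum_abs _ _
        _ ≤ ∑ i ∈ Finset.range N, 2 * (repunit i : ℤ) := Finset.sum_le_sum fun i _ => by
            rw [abs_mul, Nat.abs_cast]
            exact mul_le_mul_of_nonneg_right (ha i) (Nat.cast_nonneg _)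
        _ < repunit N := by
            rw [← Finset.mul_sum]
            exact_mod_cast two_mul_sum_repunit_lt N
    rw [Finset.sum_range_succ] at h
    have hN : a N = 0 := by
      by_contra hne
      have h1 : (1 : ℤ) ≤ |a N| := Int.one_le_abs hne
      have h2 : |a N * repunit N| < repunit N := by
        rwa [eq_neg_of_add_eq_zero_right h, abs_neg]
      rw [abs_mul, Nat.abs_cast] at h2
      nlinarith [Nat.cast_nonneg (α := ℤ) (repunit N)]
    intro i hi
    rcases Nat.lt_succ_iff_lt_or_eq.1 hi with hi | rfl
    · exact ih (by simpa [hN] using h) i hi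
    · exact hN

/-- Equal increments of `weight` have the same parity of arguments. -/
lemma parity_of_weight_add_eq {a a' b b' : ℕ}
    (h : weight a' + weight b = weight a + weight b') :
    a' % 2 + b % 2 = a % 2 + b' % 2 := by
  obtain ⟨N, hN⟩ : ∃ N, a + a' + b + b' < 2 ^ N := ⟨_, Nat.lt_two_pow_self⟩
  have hN0 : 0 < N ∨ N = 0 := by omega
  rcases hN0 with hN0 | rfl
  swap
  · obtain ⟨rfl, rfl, rfl, rfl⟩ : a = 0 ∧ a' = 0 ∧ b = 0 ∧ b' = 0 := by omega
    rfl
  rw [weight_eq_sum_testBit N (m := a) (by omega), weight_eq_sum_testBit N (m := a') (by omega),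
    weight_eq_sum_testBit N (m := b) (by omega), weight_eq_sum_testBit N (m := b') (by omega)] at h
  zify at h
  have key := eq_zero_of_sum_mul_repunit_eq_zero
    (a := fun i => ((a'.testBit i).toNat + (b.testBit i).toNat : ℤ) -
      ((a.testBit i).toNat + (b'.testBit i).toNat))
    (fun i => by
      cases a'.testBit i <;> cases b.testBit i <;> cases a.testBit i <;> cases b'.testBit i <;>
        simp) N
    (by simp only [sub_mul, add_mul, Finset.sum_sub_distrib, Finset.sum_add_distrib]; linarith)
    0 hN0
  simp only [Nat.testBit_zero, sub_eq_zero] at key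
  rcases Nat.mod_two_eq_zero_or_one a with h1 | h1 <;>
    rcases Nat.mod_two_eq_zero_or_one a' with h2 | h2 <;>
    rcases Nat.mod_two_eq_zero_or_one b with h3 | h3 <;>
    rcases Nat.mod_two_eq_zero_or_one b' with h4 | h4 <;>
    simp_all

/-! ### Return times over the dyadic odometer -/

noncomputable instance : MeasurableSpace ℤ_[2] := borel _
instance : BorelSpace ℤ_[2] := ⟨rfl⟩

/-- Normalised Haar measure on the dyadic integers. -/
noncomputable def dyadicHaar : Measure ℤ_[2] := Measure.addHaarMeasure ⊤

instance : dyadicHaar.IsAddHaarMeasure := by unfold dyadicHaar; infer_instance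
instance : IsProbabilityMeasure dyadicHaar :=
  ⟨by simpa [dyadicHaar] using
    Measure.addHaarMeasure_self (K₀ := (⊤ : TopologicalSpace.PositiveCompacts ℤ_[2]))⟩

/-- The return time to the base of the tower over the dyadic odometer. -/
noncomputable def returnTime (x : ℤ_[2]) : ℕ := gap (multiplicity 2 (x + 1))

/-- The total duration of the first `k` returns to the base. -/
noncomputable def returnSum (x : ℤ_[2]) (k : ℕ) : ℕ :=
  ∑ j ∈ Finset.range k, returnTime (x + j)

lemma returnTime_pos (x : ℤ_[2]) : 0 < returnTime x := gap_pos _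

lemma returnSum_succ (x : ℤ_[2]) (k : ℕ) :
    returnSum x (k + 1) = returnTime x + returnSum (x + 1) k := by
  rw [returnSum, Finset.sum_range_succ']
  simp [returnSum, add_comm, add_left_comm]

lemma two_pow_dvd_natCast_iff (k n : ℕ) : (2 : ℤ_[2]) ^ k ∣ n ↔ 2 ^ k ∣ n := by
  have := PadicInt.pow_p_dvd_int_iff (p := 2) k n
  norm_cast at this ⊢

lemma two_dvd_natCast_iff (n : ℕ) : (2 : ℤ_[2]) ∣ n ↔ 2 ∣ n := by
  simpa using two_pow_dvd_natCast_iff 1 n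

lemma exists_natCast_approx (x : ℤ_[2]) (N : ℕ) : ∃ a < 2 ^ N, (2 : ℤ_[2]) ^ N ∣ x - (a : ℕ) :=
  ⟨x.appr N, x.appr_lt N, by
    simpa [Ideal.mem_span_singleton] using PadicInt.appr_spec N x⟩

lemma weight_add_returnSum {x : ℤ_[2]} {N a : ℕ} (hx : (2 : ℤ_[2]) ^ N ∣ x - a) {k : ℕ}
    (hk : a + k < 2 ^ N) : weight a + returnSum x k = weight (a + k) := by
  induction k with
  | zero => simp [returnSum]
  | succ k ih =>
    have : returnTime (x + k) = gap (multiplicity 2 (a + k + 1)) := by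
      rw [returnTime, multiplicity_two_eq_of_pow_dvd (n := a + k + 1) (N := N)
        (fun j => two_pow_dvd_natCast_iff j _) _ (Nat.not_dvd_of_pos_of_lt (by omega) hk)]
      convert hx using 1
      push_cast
      ring
    rw [← add_assoc, weight_succ, ← ih (by omega), returnSum, Finset.sum_range_succ, this,
      returnSum, add_assoc a, add_assoc (weight a)]

/-- The dyadic integers whose `i`-th digit vanishes. -/
def digitZero (i : ℕ) : Set ℤ_[2] := {x | ∃ m < 2 ^ i, (2 : ℤ_[2]) ^ (i + 1) ∣ x - (m : ℕ)}

lemma mem_digitZero_or_add_mem (i : ℕ) (x : ℤ_[2]) :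
    x ∈ digitZero i ∨ x + 2 ^ i ∈ digitZero i := by
  obtain ⟨a, ha, hx⟩ := exists_natCast_approx x (i + 1)
  rcases lt_or_ge a (2 ^ i) with h | h
  · exact .inl ⟨a, h, hx⟩
  · obtain ⟨m, rfl⟩ := Nat.exists_eq_add_of_le h
    refine .inr ⟨m, by omega, ?_⟩
    have : x + 2 ^ i - (m : ℕ) = x - (2 ^ i + m : ℕ) + 2 ^ (i + 1) := by push_cast; ring
    rw [this]
    exact dvd_add hx dvd_rfl

lemma returnSum_two_pow {i : ℕ} {x : ℤ_[2]} (hx : x ∈ digitZero i) :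
    returnSum x (2 ^ i) = repunit i := by
  obtain ⟨m, hm, hx⟩ := hx
  have h := weight_add_returnSum (k := 2 ^ i) hx (by omega)
  rw [add_comm m, weight_two_pow_add hm] at h
  omega

/-- The dyadic integers from which the odometer never reaches `0`. -/
def avoidZero : Set ℤ_[2] := {x | ∀ k : ℕ, x + k ≠ 0}

lemma countable_compl_avoidZero : avoidZeroᶜ.Countable := by
  refine (Set.countable_range fun k : ℕ => -(k : ℤ_[2])).mono fun x hx => ?_
  simp only [avoidZero, mem_compl_iff, mem_ofPred_eq, not_forall, not_not] at hx
  obtain ⟨k, hk⟩ := hx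
  exact ⟨k, (eq_neg_of_add_eq_zero_left hk).symm⟩

lemma eventually_not_two_pow_dvd {y : ℤ_[2]} (hy : y ≠ 0) :
    ∀ᶠ N : ℕ in atTop, ¬ (2 : ℤ_[2]) ^ N ∣ y := by
  have hfin : FiniteMultiplicity 2 y :=
    FiniteMultiplicity.of_prime_left (by simpa using PadicInt.prime_p (p := 2)) hy
  obtain ⟨n, hn⟩ := hfin
  filter_upwards [eventually_ge_atTop (n + 1)] with N hN h
  exact hn ((pow_dvd_pow 2 hN).trans h)

lemma eventually_exists_approx_add_lt {x : ℤ_[2]} (hx : x ∈ avoidZero) (k : ℕ) :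
    ∀ᶠ N : ℕ in atTop, ∃ a : ℕ, (2 : ℤ_[2]) ^ N ∣ x - a ∧ a + k < 2 ^ N := by
  have h : ∀ᶠ N : ℕ in atTop, ∀ j ∈ Finset.range (k + 1), ¬ (2 : ℤ_[2]) ^ N ∣ x + j :=
    (Filter.eventually_all_finset _).2 fun j _ => eventually_not_two_pow_dvd (hx j)
  filter_upwards [h] with N hN
  obtain ⟨a, ha, hd⟩ := exists_natCast_approx x N
  refine ⟨a, hd, ?_⟩
  by_contra! hlt
  refine hN (2 ^ N - a) (Finset.mem_range.2 (by omega)) ?_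
  rw [Nat.cast_sub ha.le]
  have : x + ((2 ^ N : ℕ) - (a : ℕ)) = x - a + 2 ^ N := by push_cast; ring
  rw [this]
  exact dvd_add hd dvd_rfl

/-- Simultaneous returns change the parity of both points in the same way. -/
lemma two_dvd_iff_of_returnSum_eq {x y : ℤ_[2]} (hx : x ∈ avoidZero) (hy : y ∈ avoidZero)
    (hx2 : 2 ∣ x) (hy2 : 2 ∣ y) {k l : ℕ} (h : returnSum x k = returnSum y l) :
    2 ∣ x + k ↔ 2 ∣ y + l := by
  obtain ⟨N, ⟨a, hxa, hak⟩, ⟨b, hyb, hbl⟩, hN⟩ :=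
    ((eventually_exists_approx_add_lt hx k).and ((eventually_exists_approx_add_lt hy l).and
      (eventually_ge_atTop 1))).exists
  have hp := parity_of_weight_add_eq (a := a) (a' := a + k) (b := b) (b' := b + l) (by
    rw [← weight_add_returnSum hxa hak, ← weight_add_returnSum hyb hbl, h]; ring)
  have h2 : (2 : ℤ_[2]) ∣ 2 ^ N := dvd_pow_self 2 (by omega)
  have hda : 2 ∣ a := by
    rw [← two_dvd_natCast_iff]
    exact (dvd_iff_dvd_of_dvd_sub (h2.trans hxa)).1 hx2
  have hdb : 2 ∣ b := by
    rw [← two_dvd_natCast_iff]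
    exact (dvd_iff_dvd_of_dvd_sub (h2.trans hyb)).1 hy2
  rw [dvd_iff_dvd_of_dvd_sub (b := x + k) (c := ((a + k : ℕ) : ℤ_[2]))
      (by convert h2.trans hxa using 1; push_cast; ring),
    dvd_iff_dvd_of_dvd_sub (b := y + l) (c := ((b + l : ℕ) : ℤ_[2]))
      (by convert h2.trans hyb using 1; push_cast; ring),
    two_dvd_natCast_iff, two_dvd_natCast_iff]
  omega

lemma tendsto_two_pow_nhds_zero : Tendsto (fun i : ℕ => (2 : ℤ_[2]) ^ i) atTop (𝓝 0) :=
  tendsto_pow_atTop_nhds_zero_of_norm_lt_one (by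
    rw [PadicInt.norm_lt_one_iff_dvd]; exact dvd_rfl)

instance : (𝓝[≠] (0 : ℤ_[2])).NeBot :=
  (tendsto_nhdsWithin_iff.2 ⟨tendsto_two_pow_nhds_zero,
    Eventually.of_forall fun i => pow_ne_zero i two_ne_zero⟩).neBot

/-! ### Simultaneous recurrence under small translations -/

/-- Points of a set of positive measure return under finitely many small translations. -/
lemma eventually_measure_forall_add_mem_pos {G J : Type*} [AddCommGroup G] [TopologicalSpace G]
    [IsTopologicalAddGroup G] [MeasurableSpace G] [BorelSpace G] (ν : Measure G)
    [ν.IsAddHaarMeasure] [IsFiniteMeasure ν] [ν.InnerRegularCompactLTTop] [Fintype J]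
    {u : J → ℕ → G} (hu : ∀ j, Tendsto (u j) atTop (𝓝 0)) {A : Set G} (hA : MeasurableSet A)
    (hpos : 0 < ν A) : ∀ᶠ i in atTop, 0 < ν {p | ∀ j, p + u j i ∈ A} := by
  let F : C(G, C(G, G)) := ContinuousMap.curry ⟨fun q : G × G => q.2 + q.1, by fun_prop⟩
  have hsymm : ∀ j, Tendsto (fun i => ν (symmDiff (F (u j i) ⁻¹' A) (F 0 ⁻¹' A))) atTop (𝓝 0) :=
    fun j => tendsto_measure_symmDiff_preimage_nhds_zero (ν := ν)
      ((F.continuous.tendsto 0).comp (hu j))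
      (Eventually.of_forall fun i => measurePreserving_add_right ν (u j i))
      (measurePreserving_add_right ν 0) hA.nullMeasurableSet (measure_ne_top ν A)
  have hsum := tendsto_finsetSum Finset.univ fun j _ => hsymm j
  rw [Finset.sum_const_zero] at hsum
  filter_upwards [hsum.eventually_lt_const hpos] with i hi
  by_contra! hzero
  refine hi.not_ge ?_
  have hsub : A ⊆ {p | ∀ j, p + u j i ∈ A} ∪
      ⋃ j ∈ Finset.univ, symmDiff (F (u j i) ⁻¹' A) (F 0 ⁻¹' A) := fun p hp => by
    by_cases h : ∀ j, p + u j i ∈ A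
    · exact .inl h
    · push Not at h
      obtain ⟨j, hj⟩ := h
      refine .inr (mem_biUnion (Finset.mem_coe.2 (Finset.mem_univ j)) (.inr ⟨?_, hj⟩))
      change p + 0 ∈ A
      rwa [add_zero]
  calc ν A ≤ ν {p | ∀ j, p + u j i ∈ A} +
        ν (⋃ j ∈ Finset.univ, symmDiff (F (u j i) ⁻¹' A) (F 0 ⁻¹' A)) :=
        (measure_mono hsub).trans (measure_union_le _ _)
    _ ≤ 0 + ∑ j, ν (symmDiff (F (u j i) ⁻¹' A) (F 0 ⁻¹' A)) :=
        add_le_add hzero (measure_biUnion_finset_le _ _)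
    _ = _ := zero_add _

lemma ae_add_right_of_ae {G : Type*} [AddGroup G] [MeasurableSpace G] [MeasurableAdd G]
    {ν : Measure G} [ν.IsAddRightInvariant] {P : G → Prop} (h : ∀ᵐ p ∂ν, P p) (g : G) :
    ∀ᵐ p ∂ν, P (p + g) :=
  (measurePreserving_add_right ν g).quasiMeasurePreserving.ae h

lemma tendsto_natCast_mul_two_pow (n : ℕ) :
    Tendsto (fun i : ℕ => (n : ℤ_[2]) * 2 ^ i) atTop (𝓝 0) := by
  simpa using tendsto_two_pow_nhds_zero.const_mul (n : ℤ_[2])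

lemma eventually_frequently_digit_flip {A : Set ℤ_[2]} (hA : MeasurableSet A)
    (hpos : 0 < dyadicHaar A) :
    ∀ᶠ i in atTop, ∃ᵐ x ∂dyadicHaar, x ∈ A ∧ x ∈ digitZero i ∧ x + 2 ^ i ∈ A := by
  filter_upwards [eventually_measure_forall_add_mem_pos dyadicHaar
    (fun j : Fin 3 => tendsto_natCast_mul_two_pow j) hA hpos] with i hi
  intro hnot
  obtain ⟨x, hx, h0, h1⟩ := ((frequently_ae_mem_iff.2 hi.ne').and_eventually
    (hnot.and (ae_add_right_of_ae hnot (2 ^ i)))).exists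
  have hx0 : x ∈ A := by simpa using hx 0
  have hx1 : x + 2 ^ i ∈ A := by simpa using hx 1
  have hx2 : x + 2 ^ i + 2 ^ i ∈ A := by simpa [two_mul, add_assoc] using hx 2
  rcases mem_digitZero_or_add_mem i x with h | h
  · exact h0 ⟨hx0, h, hx1⟩
  · exact h1 ⟨hx1, h, hx2⟩

lemma eventually_frequently_pair_digit_flip {A : Set (ℤ_[2] × ℤ_[2])} (hA : MeasurableSet A)
    (hpos : 0 < (dyadicHaar.prod dyadicHaar) A) :
    ∀ᶠ i in atTop, ∃ᵐ p ∂dyadicHaar.prod dyadicHaar, p ∈ A ∧ p.1 ∈ digitZero i ∧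
      p.2 ∈ digitZero i ∧ p + (2 ^ i, 2 ^ i) ∈ A := by
  have hu : ∀ j : Fin 3 × Fin 3, Tendsto (fun i : ℕ =>
      (((j.1 : ℕ) : ℤ_[2]) * 2 ^ i, ((j.2 : ℕ) : ℤ_[2]) * 2 ^ i)) atTop (𝓝 0) := fun j =>
    (tendsto_natCast_mul_two_pow j.1).prodMk_nhds (tendsto_natCast_mul_two_pow j.2)
  filter_upwards [eventually_measure_forall_add_mem_pos _ hu hA hpos] with i hi
  intro hnot
  obtain ⟨⟨x, y⟩, hxy, hall⟩ := ((frequently_ae_mem_iff.2 hi.ne').and_eventually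
    (ae_all_iff.2 fun j : Fin 2 × Fin 2 => ae_add_right_of_ae hnot
      (((j.1 : ℕ) : ℤ_[2]) * 2 ^ i, ((j.2 : ℕ) : ℤ_[2]) * 2 ^ i))).exists
  obtain ⟨a, ha⟩ : ∃ a : Fin 2, x + ((a : ℕ) : ℤ_[2]) * 2 ^ i ∈ digitZero i := by
    rcases mem_digitZero_or_add_mem i x with h | h
    exacts [⟨0, by simpa using h⟩, ⟨1, by simpa using h⟩]
  obtain ⟨b, hb⟩ : ∃ b : Fin 2, y + ((b : ℕ) : ℤ_[2]) * 2 ^ i ∈ digitZero i := by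
    rcases mem_digitZero_or_add_mem i y with h | h
    exacts [⟨0, by simpa using h⟩, ⟨1, by simpa using h⟩]
  refine hall (a, b) ⟨hxy (a.castSucc, b.castSucc), ha, hb, ?_⟩
  convert hxy (a.succ, b.succ) using 1
  simp [add_mul, add_assoc]

/-! ### The tower over the dyadic odometer -/

lemma measurableSet_two_pow_dvd (k : ℕ) : MeasurableSet {x : ℤ_[2] | 2 ^ k ∣ x} := by
  have : {x : ℤ_[2] | 2 ^ k ∣ x} = {x | ‖x‖ ≤ (2 : ℕ) ^ (-k : ℤ)} := by
    ext x
    simp only [mem_ofPred_eq]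
    rw [PadicInt.norm_le_pow_iff_mem_span_pow, Ideal.mem_span_singleton]
    rfl
  rw [this]
  exact (isClosed_le continuous_norm continuous_const).measurableSet

lemma measurable_multiplicity_two : Measurable (multiplicity (2 : ℤ_[2])) := by
  refine measurable_to_countable' fun k => ?_
  have hne : multiplicity (2 : ℤ_[2]) ⁻¹' {k} \ {0} =
      ({x | 2 ^ k ∣ x} \ {x | 2 ^ (k + 1) ∣ x}) \ {0} := by
    ext x
    simp only [Set.mem_sdiff, mem_preimage, mem_singleton_iff, mem_ofPred_eq, and_congr_left_iff]
    intro hx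
    exact (FiniteMultiplicity.of_prime_left (by simpa using PadicInt.prime_p (p := 2))
      hx).multiplicity_eq_iff
  rw [← sdiff_union_inter (multiplicity (2 : ℤ_[2]) ⁻¹' {k}) {0}, hne]
  exact (((measurableSet_two_pow_dvd k).diff (measurableSet_two_pow_dvd (k + 1))).diff
    (measurableSet_singleton 0)).union
    ((finite_singleton 0).subset inter_subset_right).measurableSet

lemma measurable_returnTime : Measurable returnTime :=
  (measurable_from_nat (f := gap)).comp (measurable_multiplicity_two.comp (measurable_add_const 1))

/-- The cyclic permutation of `{0, …, f - 1}`, extended by the identity. -/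
def cyclePerm (f : ℕ) : Equiv.Perm ℕ where
  toFun n := if n + 1 < f then n + 1 else if n + 1 = f then 0 else n
  invFun n := if f ≤ n then n else if n = 0 then f - 1 else n - 1
  left_inv n := by grind
  right_inv n := by grind

/-- Climbing the tower by one level, modulo its height. -/
noncomputable def climb : (ℤ_[2] × ℕ) ≃ᵐ (ℤ_[2] × ℕ) where
  toFun p := (p.1, cyclePerm (returnTime p.1) p.2)
  invFun p := (p.1, (cyclePerm (returnTime p.1)).symm p.2)
  left_inv p := by simp
  right_inv p := by simp
  measurable_toFun := measurable_fst.prodMk (measurable_from_prod_countable_left fun n =>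
    (measurable_from_nat (f := fun f => cyclePerm f n)).comp measurable_returnTime)
  measurable_invFun := measurable_fst.prodMk (measurable_from_prod_countable_left fun n =>
    (measurable_from_nat (f := fun f => (cyclePerm f).symm n)).comp measurable_returnTime)

/-- The dyadic odometer, applied on the base level only. -/
noncomputable def baseOdometer : (ℤ_[2] × ℕ) ≃ᵐ (ℤ_[2] × ℕ) where
  toFun p := (p.1 + if p.2 = 0 then 1 else 0, p.2)
  invFun p := (p.1 - if p.2 = 0 then 1 else 0, p.2)
  left_inv p := by simp
  right_inv p := by simp
  measurable_toFun := (measurable_from_prod_countable_left fun n =>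
    (measurable_add_const (if n = 0 then (1 : ℤ_[2]) else 0) :)).prodMk measurable_snd
  measurable_invFun := (measurable_from_prod_countable_left fun n =>
    (measurable_sub_const (if n = 0 then (1 : ℤ_[2]) else 0) :)).prodMk measurable_snd

/-- The tower transformation, acting trivially above the tower. -/
noncomputable def towerMap : (ℤ_[2] × ℕ) ≃ᵐ (ℤ_[2] × ℕ) := climb.trans baseOdometer

/-- The points of the tower. -/
def tower : Set (ℤ_[2] × ℕ) := {p | p.2 < returnTime p.1}

/-- Haar measure on each level of the tower. -/
noncomputable def towerMeasure : Measure (ℤ_[2] × ℕ) :=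
  (dyadicHaar.prod Measure.count).restrict tower

instance : SigmaFinite towerMeasure := by unfold towerMeasure; infer_instance

lemma measurableSet_tower : MeasurableSet tower :=
  measurableSet_lt measurable_snd (measurable_returnTime.comp measurable_fst)

lemma map_count_perm (e : Equiv.Perm ℕ) : Measure.map e Measure.count = Measure.count := by
  ext s hs
  rw [Measure.map_apply measurable_from_nat hs, ← Equiv.image_symm_eq_preimage,
    Measure.count_injective_image e.symm.injective]

lemma measurePreserving_climb : MeasurePreserving climb
    (dyadicHaar.prod Measure.count) (dyadicHaar.prod Measure.count) :=
  (MeasurePreserving.id dyadicHaar).skew_product (g := fun x n => cyclePerm (returnTime x) n)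
    (measurable_snd.comp climb.measurable) (ae_of_all _ fun _ => map_count_perm _)

lemma measurePreserving_baseOdometer : MeasurePreserving baseOdometer
    (dyadicHaar.prod Measure.count) (dyadicHaar.prod Measure.count) := by
  have h : MeasurePreserving (fun q : ℕ × ℤ_[2] => (id q.1, q.2 + if q.1 = 0 then 1 else 0))
      (Measure.count.prod dyadicHaar) (Measure.count.prod dyadicHaar) :=
    (MeasurePreserving.id Measure.count).skew_product
      (g := fun n x => x + if n = 0 then 1 else 0)
      (measurable_from_prod_countable_right fun n =>
        (measurable_add_const (if n = 0 then (1 : ℤ_[2]) else 0) :))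
      (ae_of_all _ fun n => (measurePreserving_add_right dyadicHaar _).map_eq)
  exact (Measure.measurePreserving_swap.comp h).comp Measure.measurePreserving_swap

lemma towerMap_apply (x : ℤ_[2]) (n : ℕ) : towerMap (x, n) =
    (x + if cyclePerm (returnTime x) n = 0 then 1 else 0, cyclePerm (returnTime x) n) := rfl

lemma towerMap_of_lt {x : ℤ_[2]} {n : ℕ} (h : n + 1 < returnTime x) :
    towerMap (x, n) = (x, n + 1) := by
  simp [towerMap_apply, cyclePerm, h]

lemma towerMap_of_eq {x : ℤ_[2]} {n : ℕ} (h : n + 1 = returnTime x) :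
    towerMap (x, n) = (x + 1, 0) := by
  simp [towerMap_apply, cyclePerm, h]

lemma towerMap_of_le {x : ℤ_[2]} {n : ℕ} (h : returnTime x ≤ n) :
    towerMap (x, n) = (x, n) := by
  have := returnTime_pos x
  simp [towerMap_apply, cyclePerm, show ¬ n + 1 < returnTime x by omega,
    show n + 1 ≠ returnTime x by omega, show n ≠ 0 by omega]

lemma preimage_towerMap_tower : towerMap ⁻¹' tower = tower := by
  ext ⟨x, n⟩
  simp only [tower, mem_preimage, mem_ofPred_eq]
  rcases lt_trichotomy (n + 1) (returnTime x) with h | h | h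
  · rw [towerMap_of_lt h]; dsimp only; omega
  · rw [towerMap_of_eq h]; simp only [returnTime_pos, true_iff]; omega
  · rw [towerMap_of_le (by omega)]

lemma measurePreserving_towerMap : MeasurePreserving towerMap towerMeasure towerMeasure := by
  have h : MeasurePreserving towerMap (dyadicHaar.prod Measure.count)
      (dyadicHaar.prod Measure.count) :=
    measurePreserving_baseOdometer.comp measurePreserving_climb
  have := h.restrict_preimage measurableSet_tower
  rwa [preimage_towerMap_tower] at this

lemma iterate_towerMap_base {x : ℤ_[2]} {n : ℕ} (h : n < returnTime x) :
    towerMap^[n] (x, 0) = (x, n) := by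
  induction n with
  | zero => rfl
  | succ n ih => rw [Function.iterate_succ_apply', ih (by omega), towerMap_of_lt h]

lemma iterate_towerMap_returnTime (x : ℤ_[2]) : towerMap^[returnTime x] (x, 0) = (x + 1, 0) := by
  obtain ⟨n, hn⟩ := Nat.exists_eq_succ_of_ne_zero (returnTime_pos x).ne'
  rw [hn, Function.iterate_succ_apply', iterate_towerMap_base (by omega), towerMap_of_eq hn.symm]

lemma iterate_towerMap_returnSum (x : ℤ_[2]) (k : ℕ) :
    towerMap^[returnSum x k] (x, 0) = (x + k, 0) := by
  induction k generalizing x with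
  | zero => simp [returnSum]
  | succ k ih =>
    rw [returnSum_succ, add_comm, Function.iterate_add_apply, iterate_towerMap_returnTime, ih]
    push_cast
    ring_nf

lemma exists_returnSum_of_iterate_towerMap_eq {n : ℕ} {x y : ℤ_[2]}
    (h : towerMap^[n] (x, 0) = (y, 0)) : ∃ k : ℕ, returnSum x k = n ∧ y = x + k := by
  induction n using Nat.strong_induction_on generalizing x with
  | _ n ih =>
    rcases lt_or_ge n (returnTime x) with hn | hn
    · rw [iterate_towerMap_base hn, Prod.mk.injEq] at h
      exact ⟨0, by simp [returnSum, h.2], by simp [h.1]⟩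
    · obtain ⟨n, rfl⟩ := Nat.exists_eq_add_of_le hn
      rw [add_comm, Function.iterate_add_apply, iterate_towerMap_returnTime] at h
      obtain ⟨k, hk, hy⟩ := ih n (by have := returnTime_pos x; omega) h
      refine ⟨k + 1, by rw [returnSum_succ, hk], ?_⟩
      rw [hy]
      push_cast
      ring

lemma iterate_towerMap_repunit {i m : ℕ} {x : ℤ_[2]} (hx : x ∈ digitZero i)
    (hm : m < returnTime x) (hm' : m < returnTime (x + 2 ^ i)) :
    towerMap^[repunit i] (x, m) = (x + 2 ^ i, m) := by
  rw [← iterate_towerMap_base hm, ← Function.iterate_add_apply, add_comm,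
    Function.iterate_add_apply, ← returnSum_two_pow hx, iterate_towerMap_returnSum]
  push_cast
  exact iterate_towerMap_base hm'

lemma ae_prod_count_iff {P : ℤ_[2] × ℕ → Prop} :
    (∀ᵐ p ∂dyadicHaar.prod Measure.count, P p) ↔ ∀ᵐ x ∂dyadicHaar, ∀ n, P (x, n) := by
  refine ⟨fun h => ?_, fun h => ?_⟩
  · filter_upwards [Measure.ae_ae_of_ae_prod h] with x hx
    simpa using hx
  · exact Measure.quasiMeasurePreserving_fst.ae h |>.mono fun p hp => hp p.2

lemma ae_towerMeasure_iff {P : ℤ_[2] × ℕ → Prop} :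
    (∀ᵐ p ∂towerMeasure, P p) ↔ ∀ᵐ x ∂dyadicHaar, ∀ n < returnTime x, P (x, n) := by
  rw [towerMeasure, ae_restrict_iff' measurableSet_tower, ae_prod_count_iff]
  rfl

/-- The pairs of base points whose lifts to the levels `m` and `n` of the tower lie in `A`. -/
def levelSlice (A : Set ((ℤ_[2] × ℕ) × (ℤ_[2] × ℕ))) (m n : ℕ) : Set (ℤ_[2] × ℤ_[2]) :=
  {p | m < returnTime p.1 ∧ n < returnTime p.2 ∧ ((p.1, m), (p.2, n)) ∈ A}

lemma measurableSet_levelSlice {A : Set ((ℤ_[2] × ℕ) × (ℤ_[2] × ℕ))} (hA : MeasurableSet A)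
    (m n : ℕ) : MeasurableSet (levelSlice A m n) :=
  (measurableSet_lt measurable_const (measurable_returnTime.comp measurable_fst)).inter
    ((measurableSet_lt measurable_const (measurable_returnTime.comp measurable_snd)).inter
      ((by fun_prop : Measurable fun p : ℤ_[2] × ℤ_[2] => ((p.1, m), (p.2, n))) hA))

lemma prod_towerMeasure_eq_zero_iff {A : Set ((ℤ_[2] × ℕ) × (ℤ_[2] × ℕ))}
    (hA : MeasurableSet A) : (towerMeasure.prod towerMeasure) A = 0 ↔
      ∀ m n, (dyadicHaar.prod dyadicHaar) (levelSlice A m n) = 0 := by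
  simp only [measure_eq_zero_iff_ae_notMem]
  rw [Measure.ae_prod_iff_ae_ae hA.compl, ae_towerMeasure_iff]
  simp only [fun m n => Measure.ae_prod_iff_ae_ae (μ := dyadicHaar) (ν := dyadicHaar)
    (measurableSet_levelSlice hA m n).compl, ae_towerMeasure_iff, ← ae_all_iff]
  refine eventually_congr (ae_of_all _ fun x => ?_)
  simp only [levelSlice, mem_ofPred_eq, ae_all_iff, not_and]
  exact ⟨fun h m n hm => h m hm n, fun h m hm n => h m n hm⟩

lemma towerMeasure_singleton (p : ℤ_[2] × ℕ) : towerMeasure {p} = 0 := by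
  rw [measure_eq_zero_iff_ae_notMem, ae_towerMeasure_iff]
  filter_upwards [compl_mem_ae_iff.2 (measure_singleton (μ := dyadicHaar) p.1)] with x hx n _ h
  exact hx (congrArg Prod.fst h)

lemma one_le_two_pow_mul_dyadicHaar (k : ℕ) :
    1 ≤ 2 ^ k * dyadicHaar {x | (2 : ℤ_[2]) ^ k ∣ x + 1} := by
  have hcover : (univ : Set ℤ_[2]) ⊆
      ⋃ a ∈ Finset.range (2 ^ k), (· + (a : ℤ_[2])) ⁻¹' {x | (2 : ℤ_[2]) ^ k ∣ x + 1} := by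
    intro x _
    obtain ⟨a, ha, hd⟩ := exists_natCast_approx (-(x + 1)) k
    refine mem_biUnion (Finset.mem_coe.2 (Finset.mem_range.2 ha)) ?_
    change (2 : ℤ_[2]) ^ k ∣ x + a + 1
    rw [← dvd_neg]
    convert hd using 1
    ring
  calc (1 : ℝ≥0∞) = dyadicHaar univ := measure_univ.symm
    _ ≤ ∑ a ∈ Finset.range (2 ^ k),
          dyadicHaar ((· + (a : ℤ_[2])) ⁻¹' {x | (2 : ℤ_[2]) ^ k ∣ x + 1}) :=
        (measure_mono hcover).trans (measure_biUnion_finset_le _ _)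
    _ = _ := by simp only [measure_preimage_add_right]; simp

lemma gap_le_two_pow_mul_towerMeasure (k : ℕ) : (gap k : ℝ≥0∞) ≤ 2 ^ k * towerMeasure univ := by
  have hsub : ({x | (2 : ℤ_[2]) ^ k ∣ x + 1} \ {-1}) ×ˢ (Finset.range (gap k) : Set ℕ) ⊆ tower := by
    rintro ⟨x, n⟩ ⟨⟨hx, hne⟩, hn⟩
    have hfin : FiniteMultiplicity 2 (x + 1) :=
      FiniteMultiplicity.of_prime_left (by simpa using PadicInt.prime_p (p := 2))
        fun h => hne (eq_neg_of_add_eq_zero_left h)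
    exact (Finset.mem_range.1 hn).trans_le (gap_mono (hfin.le_multiplicity_of_pow_dvd hx))
  have hle := measure_mono (μ := dyadicHaar.prod Measure.count) hsub
  rw [Measure.prod_prod, Measure.count_apply_finset, Finset.card_range,
    measure_sdiff_null (measure_singleton _)] at hle
  calc (gap k : ℝ≥0∞) = 1 * gap k := (one_mul _).symm
    _ ≤ 2 ^ k * dyadicHaar {x | (2 : ℤ_[2]) ^ k ∣ x + 1} * gap k := by
        gcongr
        exact one_le_two_pow_mul_dyadicHaar k
    _ = 2 ^ k * (dyadicHaar {x | (2 : ℤ_[2]) ^ k ∣ x + 1} * gap k) := mul_assoc _ _ _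
    _ ≤ 2 ^ k * towerMeasure univ := by
        rw [towerMeasure, Measure.restrict_apply_univ]
        gcongr

lemma towerMeasure_univ : towerMeasure univ = ∞ := by
  by_contra hfin
  obtain ⟨k, hk⟩ := pow_unbounded_of_one_lt (2 * (towerMeasure univ).toReal)
    (by norm_num : (1 : ℝ) < 3 / 2)
  have hgap := ENNReal.toReal_mono (by finiteness) (gap_le_two_pow_mul_towerMeasure (k + 1))
  have h3 : (3 : ℝ) ^ k ≤ gap (k + 1) := mod_cast three_pow_le_gap_succ k
  simp only [ENNReal.toReal_natCast, ENNReal.toReal_mul, ENNReal.toReal_pow,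
    ENNReal.toReal_ofNat] at hgap
  rw [div_pow, lt_div_iff₀ (by positivity)] at hk
  rw [pow_succ] at hgap
  linarith

/-! ### Ergodicity with isometric coefficients -/

lemma ergodic_add_one : Ergodic (fun x : ℤ_[2] => x + 1) dyadicHaar := by
  have h : DenseRange fun k : ℤ => k • (1 : ℤ_[2]) := by
    simpa using PadicInt.denseRange_intCast (p := 2)
  simpa [add_comm] using ergodic_add_left_of_denseRange_zsmul h dyadicHaar

section Isometry

variable {Z : Type*} [MetricSpace Z] {S : Z → Z} {z w : Z} {δ : ℝ}

lemma isometry_iterate (hS : Isometry S) (n : ℕ) : Isometry S^[n] := by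
  induction n with
  | zero => exact isometry_id
  | succ n ih => exact ih.comp hS

lemma dist_iterate_lt_of_dist_lt (hS : Isometry S) {n : ℕ} (hw : dist w z < δ)
    (hSw : dist (S^[n] w) z < δ) : dist (S^[n] z) z < 2 * δ := by
  have h1 : dist (S^[n] z) (S^[n] w) = dist z w := (isometry_iterate hS n).dist_eq z w
  have h2 := dist_triangle (S^[n] z) (S^[n] w) z
  rw [dist_comm z w] at h1
  linarith

/-- If the iterates of an isometry of orders `n` and `3 * n + 1` almost fix a point, then so does
the isometry itself. -/
lemma dist_apply_lt_of_dist_iterate_lt (hS : Isometry S) {n : ℕ} (h₁ : dist (S^[n] z) z < δ)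
    (h₂ : dist (S^[3 * n + 1] z) z < δ) : dist (S z) z < 4 * δ := by
  have e1 : dist (S^[2 * n] z) (S^[n] z) = dist (S^[n] z) z := by
    rw [two_mul, Function.iterate_add_apply, (isometry_iterate hS n).dist_eq]
  have e2 : dist (S^[3 * n] z) (S^[2 * n] z) = dist (S^[n] z) z := by
    rw [show 3 * n = 2 * n + n by ring, Function.iterate_add_apply, (isometry_iterate hS _).dist_eq]
  have e3 : dist (S^[3 * n + 1] z) (S z) = dist (S^[3 * n] z) z := by
    rw [Function.iterate_succ_apply', hS.dist_eq]
  have t1 := dist_triangle (S^[3 * n] z) (S^[2 * n] z) z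
  have t2 := dist_triangle (S^[2 * n] z) (S^[n] z) z
  have t3 := dist_triangle_left (S z) z (S^[3 * n + 1] z)
  linarith

end Isometry

theorem eic_towerMap : EIC towerMeasure towerMap := by
  intro Z _ _ _ _ S φ hφ hTS
  have hS : Isometry S := S.isometry
  have hiter : ∀ n, ∀ᵐ p ∂towerMeasure, φ (towerMap^[n] p) = S^[n] (φ p) := fun n => by
    induction n with
    | zero => exact ae_of_all _ fun _ => rfl
    | succ n ih =>
      filter_upwards [ih, (measurePreserving_towerMap.iterate n).quasiMeasurePreserving.ae hTS]
        with p hp hq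
      rw [Function.iterate_succ_apply', hq, hp, Function.iterate_succ_apply']
  set ψ : ℤ_[2] → Z := fun x => φ (x, 0)
  have hψ : Measurable ψ := hφ.comp (measurable_id.prodMk measurable_const)
  have hbase : ∀ᵐ x ∂dyadicHaar, ∀ n, φ (towerMap^[n] (x, 0)) = S^[n] (ψ x) :=
    ((ae_towerMeasure_iff.1 (ae_all_iff.2 hiter))).mono fun x hx => hx 0 (returnTime_pos x)
  have hlocal : ∀ z : Z, ∀ δ > 0, dyadicHaar (ψ ⁻¹' Metric.ball z δ) ≠ 0 →
      dist (S z) z < 8 * δ := by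
    intro z δ hδ hne
    have hev := eventually_frequently_digit_flip (hψ measurableSet_ball) (pos_iff_ne_zero.2 hne)
    obtain ⟨i, hi, hi'⟩ := (hev.and ((tendsto_add_atTop_nat 1).eventually hev)).exists
    have hrep : ∀ j, (∃ᵐ x ∂dyadicHaar, x ∈ ψ ⁻¹' Metric.ball z δ ∧ x ∈ digitZero j ∧
        x + 2 ^ j ∈ ψ ⁻¹' Metric.ball z δ) → dist (S^[repunit j] z) z < 2 * δ := fun j hj => by
      obtain ⟨x, ⟨hx, hd, hx'⟩, hb⟩ := (hj.and_eventually hbase).exists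
      refine dist_iterate_lt_of_dist_lt hS hx ?_
      rw [← hb, iterate_towerMap_repunit hd (returnTime_pos _) (returnTime_pos _)]
      exact hx'
    have := dist_apply_lt_of_dist_iterate_lt hS (hrep i hi) (hrep (i + 1) hi')
    linarith
  have hclose : ∀ m : ℕ, ∀ᵐ x ∂dyadicHaar, dist (S (ψ x)) (ψ x) ≤ 10 * (1 / (m + 1 : ℝ)) := by
    intro m
    have hδ : (0 : ℝ) < 1 / (m + 1 : ℝ) := by positivity
    obtain ⟨s, hsc, hsd⟩ := TopologicalSpace.exists_countable_dense Z
    have hall : ∀ᵐ x ∂dyadicHaar, ∀ z ∈ s, ψ x ∈ Metric.ball z (1 / (m + 1 : ℝ)) →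
        dyadicHaar (ψ ⁻¹' Metric.ball z (1 / (m + 1 : ℝ))) ≠ 0 := by
      refine (ae_ball_iff hsc).2 fun z _ => ?_
      by_cases h0 : dyadicHaar (ψ ⁻¹' Metric.ball z (1 / (m + 1 : ℝ))) = 0
      · filter_upwards [measure_eq_zero_iff_ae_notMem.1 h0] with x hx h using absurd h hx
      · exact ae_of_all _ fun _ _ => h0
    filter_upwards [hall] with x hx
    obtain ⟨z, hz, hd⟩ := hsd.exists_dist_lt (ψ x) hδ
    have h1 := hlocal z _ hδ (hx z hz hd)
    have h2 := dist_triangle4 (S (ψ x)) (S z) z (ψ x)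
    rw [hS.dist_eq, dist_comm z] at h2
    linarith
  have hfix : ∀ᵐ x ∂dyadicHaar, S (ψ x) = ψ x := by
    filter_upwards [ae_all_iff.2 hclose] with x hx
    have hlim : Tendsto (fun m : ℕ => 10 * (1 / (m + 1 : ℝ))) atTop (𝓝 0) := by
      simpa using (tendsto_one_div_add_atTop_nhds_zero_nat (𝕜 := ℝ)).const_mul 10
    exact dist_le_zero.1 (ge_of_tendsto' hlim hx)
  have hinv : ψ ∘ (fun x => x + 1) =ᵐ[dyadicHaar] ψ := by
    filter_upwards [hbase, hfix] with x hx hf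
    have := hx (returnTime x)
    rw [iterate_towerMap_returnTime, Function.iterate_fixed hf] at this
    exact this
  have : Nonempty Z := ⟨ψ 0⟩
  obtain ⟨z, hz⟩ := ergodic_add_one.quasiErgodic.ae_eq_const_of_ae_eq_comp_ae
    hψ.aestronglyMeasurable hinv
  refine ⟨z, ae_towerMeasure_iff.2 ?_⟩
  filter_upwards [hbase, hfix, hz] with x hx hf hxz n hn
  rw [← iterate_towerMap_base hn, hx, Function.iterate_fixed hf]
  exact hxz

/-! ### The cartesian square -/

theorem isConservative_towerMap_square :
    IsConservative (towerMeasure.prod towerMeasure) (Prod.map towerMap towerMap) := by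
  intro A hA hpos
  obtain ⟨m, n, hmn⟩ : ∃ m n, (dyadicHaar.prod dyadicHaar) (levelSlice A m n) ≠ 0 := by
    by_contra! h
    exact hpos.ne' ((prod_towerMeasure_eq_zero_iff hA).2 h)
  obtain ⟨i, hi⟩ := (eventually_frequently_pair_digit_flip (measurableSet_levelSlice hA m n)
    (pos_iff_ne_zero.2 hmn)).exists
  have hmeas : Measurable (Prod.map towerMap towerMap) :=
    towerMap.measurable.prodMap towerMap.measurable
  refine ⟨repunit i, (Nat.one_le_pow _ _ (by norm_num)).trans (three_pow_le_repunit i),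
    pos_iff_ne_zero.2 fun h0 => ?_⟩
  have hnull := (prod_towerMeasure_eq_zero_iff (hA.inter (hmeas.iterate _ hA))).1 h0 m n
  obtain ⟨⟨x, y⟩, ⟨⟨hm, hn, hxy⟩, hx, hy, hm', hn', hxy'⟩, hnot⟩ :=
    (hi.and_eventually (measure_eq_zero_iff_ae_notMem.1 hnull)).exists
  refine hnot ⟨hm, hn, hxy, ?_⟩
  rw [mem_preimage, Prod.map_iterate, Prod.map_apply, iterate_towerMap_repunit hx hm hm',
    iterate_towerMap_repunit hy hn hn']
  exact hxy'

lemma measurePreserving_towerMap_square : MeasurePreserving (Prod.map towerMap towerMap)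
    (towerMeasure.prod towerMeasure) (towerMeasure.prod towerMeasure) :=
  measurePreserving_towerMap.prod measurePreserving_towerMap

lemma conservative_towerMap_square :
    Conservative (Prod.map towerMap towerMap) (towerMeasure.prod towerMeasure) where
  toQuasiMeasurePreserving := measurePreserving_towerMap_square.quasiMeasurePreserving
  exists_mem_iterate_mem' s hs hne := by
    obtain ⟨n, hn, hpos⟩ := isConservative_towerMap_square s hs (pos_iff_ne_zero.2 hne)
    obtain ⟨p, hp, hpn⟩ := nonempty_of_measure_ne_zero hpos.ne'
    exact ⟨p, hp, n, by omega, hpn⟩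

/-- Pairs of base points with first coordinates in `s` and `t`. -/
def basePairs (s t : Set ℤ_[2]) : Set ((ℤ_[2] × ℕ) × (ℤ_[2] × ℕ)) :=
  (s ×ˢ {0}) ×ˢ (t ×ˢ {0})

lemma measurableSet_basePairs {s t : Set ℤ_[2]} (hs : MeasurableSet s) (ht : MeasurableSet t) :
    MeasurableSet (basePairs s t) :=
  (hs.prod (measurableSet_singleton 0)).prod (ht.prod (measurableSet_singleton 0))

lemma measure_basePairs_ne_zero {s t : Set ℤ_[2]} (hs : MeasurableSet s) (ht : MeasurableSet t)
    (hs0 : dyadicHaar s ≠ 0) (ht0 : dyadicHaar t ≠ 0) :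
    (towerMeasure.prod towerMeasure) (basePairs s t) ≠ 0 := by
  intro h
  have h0 := (prod_towerMeasure_eq_zero_iff (measurableSet_basePairs hs ht)).1 h 0 0
  have : levelSlice (basePairs s t) 0 0 = s ×ˢ t := by
    ext p
    simp [levelSlice, basePairs, returnTime_pos]
  rw [this, Measure.prod_prod] at h0
  exact mul_ne_zero hs0 ht0 h0

lemma dyadicHaar_even_ne_zero : dyadicHaar {x | 2 ∣ x} ≠ 0 := by
  have h := one_le_two_pow_mul_dyadicHaar 1
  intro h0
  have : {x : ℤ_[2] | (2 : ℤ_[2]) ^ 1 ∣ x + 1} = (· + 1) ⁻¹' {x | 2 ∣ x} := by simp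
  rw [this, measure_preimage_add_right, h0] at h
  simp at h

lemma dyadicHaar_odd_ne_zero : dyadicHaar {x | 2 ∣ x}ᶜ ≠ 0 := by
  have : (· + 1) ⁻¹' {x : ℤ_[2] | 2 ∣ x} ⊆ {x | 2 ∣ x}ᶜ := fun x hx hx' =>
    (by simpa using PadicInt.prime_p (p := 2) : Prime (2 : ℤ_[2])).not_dvd_one
      ((dvd_add_right hx').1 hx)
  intro h0
  have h := measure_mono_null this h0
  rw [measure_preimage_add_right] at h
  exact dyadicHaar_even_ne_zero h

lemma dyadicHaar_even_inter_avoidZero_ne_zero : dyadicHaar ({x | 2 ∣ x} ∩ avoidZero) ≠ 0 := by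
  rw [← sdiff_compl, measure_sdiff_null (countable_compl_avoidZero.measure_zero _)]
  exact dyadicHaar_even_ne_zero

theorem not_isErgodicT_towerMap_square :
    ¬ IsErgodicT (towerMeasure.prod towerMeasure) (Prod.map towerMap towerMap) := by
  intro herg
  set R := Prod.map towerMap towerMap
  have hE : MeasurableSet {x : ℤ_[2] | 2 ∣ x} := by simpa using measurableSet_two_pow_dvd 1
  have hE' : MeasurableSet ({x : ℤ_[2] | 2 ∣ x} ∩ avoidZero) :=
    hE.inter (by simpa using countable_compl_avoidZero.measurableSet.compl)
  set W := basePairs {x | 2 ∣ x} {x | 2 ∣ x}ᶜ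
  have hW : MeasurableSet W := measurableSet_basePairs hE hE.compl
  set A := {p | ∃ᶠ n in atTop, R^[n] p ∈ W}
  have hA : MeasurableSet A := by
    have : A = ⋂ m, ⋃ n ≥ m, R^[n] ⁻¹' W := by
      ext p
      simp [A, frequently_atTop]
    rw [this]
    exact .iInter fun m => .iUnion fun n => .iUnion fun _ =>
      measurePreserving_towerMap_square.measurable.iterate n hW
  have hinv : R ⁻¹' A = A := by
    ext p
    change (∃ᶠ n in atTop, R^[n + 1] p ∈ W) ↔ ∃ᶠ n in atTop, R^[n] p ∈ W
    conv_rhs => rw [← map_add_atTop_eq_nat 1, frequently_map]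
  rcases herg A hA hinv with h | h
  · refine measure_basePairs_ne_zero hE hE.compl dyadicHaar_even_ne_zero dyadicHaar_odd_ne_zero
      (measure_eq_zero_iff_ae_notMem.2 ?_)
    filter_upwards [conservative_towerMap_square.ae_mem_imp_frequently_image_mem
      hW.nullMeasurableSet, measure_eq_zero_iff_ae_notMem.1 h] with p hp hpA hpW
    exact hpA (hp hpW)
  · refine measure_basePairs_ne_zero hE' hE' dyadicHaar_even_inter_avoidZero_ne_zero
      dyadicHaar_even_inter_avoidZero_ne_zero (measure_mono_null ?_ h)
    rintro ⟨⟨x, _⟩, ⟨y, _⟩⟩ ⟨⟨⟨hx, hxa⟩, rfl⟩, ⟨⟨hy, hya⟩, rfl⟩⟩ hmem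
    obtain ⟨n, hn⟩ := hmem.exists
    rw [Prod.map_iterate, Prod.map_apply] at hn
    obtain ⟨⟨hx', hx0⟩, ⟨hy', hy0⟩⟩ := hn
    obtain ⟨k, hk, hxk⟩ := exists_returnSum_of_iterate_towerMap_eq (Prod.ext rfl hx0)
    obtain ⟨l, hl, hyl⟩ := exists_returnSum_of_iterate_towerMap_eq (Prod.ext rfl hy0)
    replace hx' : 2 ∣ x + k := hxk.subst (motive := fun z => 2 ∣ z) hx'
    replace hy' : ¬ 2 ∣ y + l := hyl.subst (motive := fun z => ¬ 2 ∣ z) hy'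
    have hiff := two_dvd_iff_of_returnSum_eq hxa hya hx hy (hk.trans hl.symm)
    rw [hiff] at hx'
    contradiction

/-- There is an invertible measure-preserving transformation `T` of an infinite nonatomic
σ-finite measure space which is ergodic with isometric coefficients and whose cartesian
square is conservative but not ergodic. -/
theorem exists_eic_squareConservative_squareNotErgodic :
    ∃ (X : Type) (_ : MeasurableSpace X) (μ : Measure X) (_ : SigmaFinite μ) (T : X ≃ᵐ X),
      (∀ x : X, μ {x} = 0) ∧ μ Set.univ = ∞ ∧
      MeasurePreserving T μ μ ∧
      EIC μ T ∧
      IsConservative (μ.prod μ) (Prod.map T T) ∧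
      ¬ IsErgodicT (μ.prod μ) (Prod.map T T) := by
  exact ⟨ℤ_[2] × ℕ, inferInstance, towerMeasure, inferInstance, towerMap,
    towerMeasure_singleton, towerMeasure_univ, measurePreserving_towerMap, eic_towerMap,
    isConservative_towerMap_square, not_isErgodicT_towerMap_square⟩
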